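/- arXiv:2210.08422 — 4 statements merged into one kernel-verified Lean document; each statement's English description precedes it below -/
import Mathlib

section
/- Let $U : (0,\infty) \to \mathbb{R}$ be twice continuously differentiable and strictly concave with $U'(c) \to +\infty$ as $c \to 0^+$ and $U'(c) \to 0$ as $c \to +\infty$, and let $I := (U')^{-1}$. Suppose there are constants $c_0 > 0$, $\zeta \in (0,1)$ and $\iota > 1$ such that $\zeta U'(c) \ge U'(\iota c)$ for all $c > c_0$. Then there exists $y_0 > 0$ such that $I(\zeta y) \le \iota\, I(y)$ for all $0 < y < y_0$. -/
open Filter Set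

/-- Under the Inada conditions, if `ζ U'(c) ≥ U'(ι c)` for all
`c > c₀` (with `ζ ∈ (0,1)`, `ι > 1`), then there exists `y₀ > 0` such that
`I(ζ y) ≤ ι I(y)` for all `0 < y < y₀`. -/
theorem inverse_marginal_utility_elasticity (U U' I : ℝ → ℝ)
    (hC2 : ContDiffOn ℝ 2 U (Set.Ioi 0))
    (hderiv : ∀ c ∈ Set.Ioi (0 : ℝ), HasDerivAt U (U' c) c)
    (hconc : StrictConcaveOn ℝ (Set.Ioi 0) U)
    (hInada0 : Tendsto U' (nhdsWithin 0 (Set.Ioi 0)) atTop)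
    (hInadaInf : Tendsto U' atTop (nhds 0))
    (hIpos : ∀ y ∈ Set.Ioi (0 : ℝ), I y ∈ Set.Ioi (0 : ℝ))
    (hIinv : ∀ y ∈ Set.Ioi (0 : ℝ), U' (I y) = y)
    (hIinv' : ∀ c ∈ Set.Ioi (0 : ℝ), I (U' c) = c)
    (c₀ ζ ι : ℝ) (hc₀ : 0 < c₀) (hζ0 : 0 < ζ) (hζ1 : ζ < 1) (hι : 1 < ι)
    (hcond : ∀ c : ℝ, c₀ < c → U' (ι * c) ≤ ζ * U' c) :
    ∃ y₀ : ℝ, 0 < y₀ ∧ ∀ y : ℝ, 0 < y → y < y₀ → I (ζ * y) ≤ ι * I y := by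
  have anti : ∀ a b : ℝ, 0 < a → a < b → U' b < U' a := by
    intro a b ha hab
    have hb : 0 < b := ha.trans hab
    have h1 := hconc.slope_lt_of_hasDerivAt (mem_Ioi.2 ha) (mem_Ioi.2 hb) hab (hderiv a ha)
    have h2 := hconc.lt_slope_of_hasDerivAt (mem_Ioi.2 ha) (mem_Ioi.2 hb) hab (hderiv b hb)
    exact h2.trans h1
  have pos : 0 < U' c₀ := by
    have h1 : 0 ≤ U' (c₀ + 1) := by
      refine le_of_tendsto hInadaInf ?_
      filter_upwards [eventually_gt_atTop (c₀ + 1)] with x hx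
      exact (anti _ _ (by linarith) hx).le
    exact h1.trans_lt (anti _ _ hc₀ (by linarith))
  refine ⟨U' c₀, pos, fun y hy hyy => ?_⟩
  have hI : 0 < I y := hIpos y hy
  have hc : c₀ < I y := by
    by_contra hn
    rcases (not_lt.1 hn).lt_or_eq with h | h
    · have := anti _ _ hI h
      rw [hIinv y hy] at this
      linarith
    · have := hIinv y hy
      rw [h] at this
      linarith
  have h1 := hcond _ hc
  rw [hIinv y hy] at h1
  by_contra hn
  have h2 := anti (ι * I y) (I (ζ * y)) (by positivity) (not_le.1 hn)
  rw [hIinv (ζ * y) (mem_Ioi.2 (by positivity))] at h2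
  linarith
end

section
/- Let $a_1, a_2 > 0$, $\lambda > 0$, $\theta_1, \theta_2 \in \mathbb{R}$, and let $f_1, f_2$ be probability densities on a common support $\mathcal{Z} \subseteq \mathbb{R}$ with $f_2(z)/f_1(z) < b_{\max}$ for all $z \in \mathcal{Z}$ for some constant $b_{\max} > 1$. Define $\hat{f}(x,z) := f_1(z)x + f_2(z)(1-x)$, $\xi(x,z) := f_1(z)x/\hat{f}(x,z)$, and for $\phi \in C^2((0,1))$ the generator $\mathcal{L}\phi(x) := (a_2-(a_1+a_2)x)\phi'(x) + \frac{1}{2}x^2(1-x)^2(\theta_1-\theta_2)^2\phi''(x) + \lambda\int_{\mathcal{Z}}[\phi(\xi(x,z)) - \phi(x)]\hat{f}(x,z)\,dz$. Then for $\phi(x) = 1/x$ and every $x \in (0,1)$, $\mathcal{L}\phi(x) \le L_0\,\phi(x)$, where $L_0 := a_1 + a_2 + (\theta_1-\theta_2)^2 + \lambda(b_{\max}-1)$. -/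
open MeasureTheory Set

/-- Lyapunov estimate for the filter generator at `φ(x) = 1/x`.
For the generator
`𝓛φ(x) = (a₂-(a₁+a₂)x) φ'(x) + ½ x²(1-x)²(θ₁-θ₂)² φ''(x)
          + λ ∫_Z [φ(ξ(x,z)) - φ(x)] f̂(x,z) dz`,
one has `𝓛φ(x) ≤ L₀ φ(x)` for all `x ∈ (0,1)`, where
`L₀ = a₁ + a₂ + (θ₁-θ₂)² + λ(b_max - 1)`. -/
theorem filter_generator_lyapunov (a₁ a₂ lam θ₁ θ₂ : ℝ)
    (ha₁ : 0 < a₁) (ha₂ : 0 < a₂) (hlam : 0 < lam)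
    (bmax : ℝ) (hb : 1 < bmax)
    (Z : Set ℝ) (hZ : MeasurableSet Z) (f₁ f₂ : ℝ → ℝ)
    (hf₁m : Measurable f₁) (hf₂m : Measurable f₂)
    (hf₁pos : ∀ z ∈ Z, 0 < f₁ z) (hf₂pos : ∀ z ∈ Z, 0 < f₂ z)
    (hf₁int : IntegrableOn f₁ Z) (hf₂int : IntegrableOn f₂ Z)
    (hf₁d : (∫ z in Z, f₁ z) = 1) (hf₂d : (∫ z in Z, f₂ z) = 1)
    (hratio : ∀ z ∈ Z, f₂ z / f₁ z < bmax)
    (fhat : ℝ → ℝ → ℝ) (hfhat : fhat = fun x z => f₁ z * x + f₂ z * (1 - x))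
    (ξ : ℝ → ℝ → ℝ) (hξ : ξ = fun x z => f₁ z * x / fhat x z)
    (L₀ : ℝ) (hL₀ : L₀ = a₁ + a₂ + (θ₁ - θ₂) ^ 2 + lam * (bmax - 1)) :
    ∀ x ∈ Set.Ioo (0 : ℝ) 1,
      (a₂ - (a₁ + a₂) * x) * (-(1 / x ^ 2)) +
        (1 / 2) * x ^ 2 * (1 - x) ^ 2 * (θ₁ - θ₂) ^ 2 * (2 / x ^ 3) +
        lam * ∫ z in Z, (1 / ξ x z - 1 / x) * fhat x z ≤ L₀ * (1 / x) := by
  rintro x ⟨hx0, hx1⟩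
  have hy : 0 < 1 - x := by linarith
  have hint : (∫ z in Z, (1 / ξ x z - 1 / x) * fhat x z) ≤ (bmax - 1) * (1 / x) := by
    by_cases hI : IntegrableOn (fun z => (1 / ξ x z - 1 / x) * fhat x z) Z
    · have hF : IntegrableOn (fun z => f₁ z * x + f₂ z * (1 - x)) Z :=
        (hf₁int.mul_const x).add (hf₂int.mul_const (1 - x))
      have hFi : (∫ z in Z, (f₁ z * x + f₂ z * (1 - x))) = 1 := by
        rw [integral_add (hf₁int.mul_const x) (hf₂int.mul_const (1 - x)),
          integral_mul_const, integral_mul_const, hf₁d, hf₂d]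
        ring
      calc (∫ z in Z, (1 / ξ x z - 1 / x) * fhat x z)
          ≤ ∫ z in Z, ((bmax - 1) * (1 / x)) * (f₁ z * x + f₂ z * (1 - x)) := by
            refine setIntegral_mono_on hI (hF.const_mul _) hZ ?_
            intro z hz
            have h1 := hf₁pos z hz
            have h2 := hf₂pos z hz
            have hr := (div_lt_iff₀ h1).1 (hratio z hz)
            have hp : 0 < f₁ z * x + f₂ z * (1 - x) := by positivity
            subst hξ
            subst hfhat
            refine mul_le_mul_of_nonneg_right ?_ hp.le
            have e : 1 / (f₁ z * x / (f₁ z * x + f₂ z * (1 - x)))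
                = ((f₁ z * x + f₂ z * (1 - x)) / f₁ z) * (1 / x) := by
              field_simp
            have hle : (f₁ z * x + f₂ z * (1 - x)) / f₁ z ≤ bmax := by
              rw [div_le_iff₀ h1]
              nlinarith [mul_pos h1 hx0, mul_pos (mul_pos h1 hx0) (sub_pos.2 hb),
                mul_pos (sub_pos.2 hr) hy]
            have hxi : 0 < 1 / x := by positivity
            have := mul_le_mul_of_nonneg_right hle hxi.le
            simp only [e]
            linarith
        _ = (bmax - 1) * (1 / x) := by
            rw [integral_const_mul, hFi, mul_one]
    · rw [integral_undef hI]
      have : 0 < bmax - 1 := by linarith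
      positivity
  have h3 := mul_le_mul_of_nonneg_left hint hlam.le
  have h4 : (a₂ - (a₁ + a₂) * x) * (-(1 / x ^ 2)) = (a₁ + a₂) * (1 / x) - a₂ / x ^ 2 := by
    field_simp
    ring
  have h5 : (1 / 2) * x ^ 2 * (1 - x) ^ 2 * (θ₁ - θ₂) ^ 2 * (2 / x ^ 3)
      = ((1 - x) ^ 2 * (θ₁ - θ₂) ^ 2) * (1 / x) := by
    field_simp
  have h6 : ((1 - x) ^ 2 * (θ₁ - θ₂) ^ 2) * (1 / x) ≤ (θ₁ - θ₂) ^ 2 * (1 / x) := by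
    refine mul_le_mul_of_nonneg_right ?_ (by positivity)
    refine mul_le_of_le_one_left (sq_nonneg _) ?_
    nlinarith
  have h7 : 0 < a₂ / x ^ 2 := by positivity
  rw [h4, h5, hL₀]
  linarith
end

section
/- Let $f_1, f_2$ be probability densities on a common support $\mathcal{Z} \subseteq \mathbb{R}$ satisfying the BLR condition together with $\int_{\mathcal{Z}} f_1(z)^3/f_2(z)^2\,dz < \infty$, let $\lambda > 0$, $T > 0$, and let $\beta \in (0,1) \cup (-\infty, 0)$. Let $g : [0,T]\times[0,1] \to \mathbb{R}$ satisfy $0 < C_{\ell} \le g(t,x) \le C_u$ for all $(t,x)$ and $|g(t,x) - g(t,y)| \le L|x-y|$ for all $t \in [0,T]$ and $x,y \in [0,1]$, for constants $C_{\ell}, C_u, L$. Define $\hat{f}(x,z) := f_1(z)x + f_2(z)(1-x)$, $\xi(x,z) := f_1(z)x/\hat{f}(x,z)$, and $\mathcal{I}_{\beta}[g](t,x) := (1-\beta)\lambda\int_{\mathcal{Z}}\left[g(t,x)^{\beta/(\beta-1)}\,g(t,\xi(x,z))^{1/(1-\beta)} - g(t,x)\right]\hat{f}(x,z)\,dz$.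 Then $\mathcal{I}_{\beta}[g]$ is bounded on $[0,T]\times[0,1]$, and there exists a constant $C' > 0$ such that $|\mathcal{I}_{\beta}[g](t,x) - \mathcal{I}_{\beta}[g](t,y)| \le C'|x-y|$ for all $t \in [0,T]$ and $x, y \in [0,1]$. -/
open MeasureTheory Set

lemma aux_rpow (Cl Cu r : ℝ) (hCl : 0 < Cl) : ∃ M K : ℝ, 0 ≤ M ∧ 0 ≤ K ∧
    (∀ a ∈ Icc Cl Cu, |a ^ r| ≤ M) ∧
    (∀ a ∈ Icc Cl Cu, ∀ b ∈ Icc Cl Cu, |a ^ r - b ^ r| ≤ K * |a - b|) := by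
  have hc : ∀ s : ℝ, ContinuousOn (fun a : ℝ => a ^ s) (Icc Cl Cu) := fun s =>
    continuousOn_id.rpow_const (fun a ha => Or.inl (lt_of_lt_of_le hCl ha.1).ne')
  obtain ⟨M, hM⟩ := isCompact_Icc.exists_bound_of_continuousOn (hc r)
  obtain ⟨K, hK⟩ := isCompact_Icc.exists_bound_of_continuousOn
    ((hc (r - 1)).const_mul r)
  refine ⟨|M|, |K|, abs_nonneg _, abs_nonneg _, fun a ha => (hM a ha).trans (le_abs_self M), ?_⟩
  intro a ha b hb
  exact (convex_Icc Cl Cu).norm_image_sub_le_of_norm_hasDerivWithin_le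
    (f := fun a : ℝ => a ^ r) (f' := fun a => r * a ^ (r - 1))
    (fun x hx => (Real.hasDerivAt_rpow_const
      (Or.inl (lt_of_lt_of_le hCl hx.1).ne')).hasDerivWithinAt)
    (fun x hx => (hK x hx).trans (le_abs_self K)) hb ha

lemma aux_xi (a b x : ℝ) (ha : 0 < a) (hb : 0 < b) (hx : x ∈ Icc (0:ℝ) 1) :
    0 < a * x + b * (1 - x) ∧ a * x + b * (1 - x) ≤ a + b ∧
    a * x / (a * x + b * (1 - x)) ∈ Icc (0:ℝ) 1 := by
  obtain ⟨h0, h1⟩ := hx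
  have hax : 0 ≤ a * x := by positivity
  have hbx : 0 ≤ b * (1 - x) := mul_nonneg hb.le (by linarith)
  have hp : 0 < a * x + b * (1 - x) := by
    rcases h0.eq_or_lt with h | h
    · subst h; simpa using hb
    · have : 0 < a * x := by positivity
      linarith
  refine ⟨hp, by nlinarith, by positivity, ?_⟩
  rw [div_le_one hp]; linarith

lemma aux_xi_lip (a b x y : ℝ) (ha : 0 < a) (hb : 0 < b) (hx : x ∈ Icc (0:ℝ) 1)
    (hy : y ∈ Icc (0:ℝ) 1) :
    |a * x / (a * x + b * (1 - x)) - a * y / (a * y + b * (1 - y))| * (a * x + b * (1 - x))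
      ≤ (a + b) * |x - y| := by
  obtain ⟨hpx, -, -⟩ := aux_xi a b x ha hb hx
  obtain ⟨hpy, -, -⟩ := aux_xi a b y ha hb hy
  have e : a * x / (a * x + b * (1 - x)) - a * y / (a * y + b * (1 - y)) =
      (a * b / (a * y + b * (1 - y))) * (x - y) / (a * x + b * (1 - x)) := by
    field_simp; ring
  rw [e, abs_div, abs_mul, abs_of_pos hpx, div_mul_cancel₀ _ hpx.ne',
    abs_of_pos (by positivity : 0 < a * b / (a * y + b * (1 - y)))]
  refine mul_le_mul_of_nonneg_right ?_ (abs_nonneg _)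
  rw [div_le_iff₀ hpy]
  have h1 : 0 ≤ a * a * y := mul_nonneg (by positivity) hy.1
  have h2 : 0 ≤ b * b * (1 - y) := mul_nonneg (by positivity) (by linarith [hy.2])
  nlinarith

lemma aux_alg (A A' B B' G G' f f' s d MA MB MG KA KB KG : ℝ)
    (hMA : 0 ≤ MA) (hMB : 0 ≤ MB) (hMG : 0 ≤ MG) (hKA : 0 ≤ KA) (hKG : 0 ≤ KG) (hd : 0 ≤ d)
    (hf : 0 ≤ f) (hfs : f ≤ s)
    (hA' : |A'| ≤ MA) (hB : |B| ≤ MB) (hB' : |B'| ≤ MB) (hG' : |G'| ≤ MG)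
    (hA : |A - A'| ≤ KA * d) (hBB : |B - B'| * f ≤ KB * (s * d)) (hG : |G - G'| ≤ KG * d)
    (hff : |f - f'| ≤ s * d) :
    |(A * B - G) * f - (A' * B' - G') * f'| ≤
      (KA * MB + MA * KB + MA * MB + KG + MG) * d * s := by
  have hs : 0 ≤ s := hf.trans hfs
  have hsd : 0 ≤ s * d := by positivity
  have e : (A * B - G) * f - (A' * B' - G') * f' =
    (A - A') * B * f + A' * ((B - B') * f) + A' * B' * (f - f') + -((G - G') * f)
      + -(G' * (f - f')) := by ring
  rw [e]
  have h1 : |(A - A') * B * f| ≤ KA * d * MB * s := by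
    rw [abs_mul, abs_mul, abs_of_nonneg hf]; gcongr
  have h2 : |A' * ((B - B') * f)| ≤ MA * (KB * (s * d)) := by
    rw [abs_mul, abs_mul (B - B'), abs_of_nonneg hf]
    exact mul_le_mul hA' hBB (by positivity) hMA
  have h3 : |A' * B' * (f - f')| ≤ MA * MB * (s * d) := by
    rw [abs_mul, abs_mul]; gcongr
  have h4 : |-((G - G') * f)| ≤ KG * d * s := by
    rw [abs_neg, abs_mul, abs_of_nonneg hf]; gcongr
  have h5 : |-(G' * (f - f'))| ≤ MG * (s * d) := by
    rw [abs_neg, abs_mul]; gcongr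
  have := abs_add_le ((A - A') * B * f + A' * ((B - B') * f) + A' * B' * (f - f') + -((G - G') * f)) (-(G' * (f - f')))
  have := abs_add_le ((A - A') * B * f + A' * ((B - B') * f) + A' * B' * (f - f')) (-((G - G') * f))
  have := abs_add_le ((A - A') * B * f + A' * ((B - B') * f)) (A' * B' * (f - f'))
  have := abs_add_le ((A - A') * B * f) (A' * ((B - B') * f))
  linarith

/-- Under the BLR condition (with `∫ f₁³/f₂² < ∞`), for every
function `g` on `[0,T] × [0,1]` bounded between positive constants and
Lipschitz in its second argument, the optimized nonlocal jump operator
`𝓘_β[g](t,x) = (1-β) λ ∫_Z [g(t,x)^(β/(β-1)) g(t,ξ(x,z))^(1/(1-β)) - g(t,x)] f̂(x,z) dz`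
is bounded on `[0,T] × [0,1]` and Lipschitz continuous in `x`. -/
theorem nonlocal_operator_bounded_lipschitz
    (Z : Set ℝ) (hZ : MeasurableSet Z) (f₁ f₂ : ℝ → ℝ)
    (hf₁m : Measurable f₁) (hf₂m : Measurable f₂)
    (hf₁pos : ∀ z ∈ Z, 0 < f₁ z) (hf₂pos : ∀ z ∈ Z, 0 < f₂ z)
    (hf₁int : IntegrableOn f₁ Z) (hf₂int : IntegrableOn f₂ Z)
    (hf₁d : (∫ z in Z, f₁ z) = 1) (hf₂d : (∫ z in Z, f₂ z) = 1)
    (bmin bmax : ℝ) (hbmin0 : 0 ≤ bmin) (hbmin1 : bmin < 1) (hbmax : 1 < bmax)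
    (hratio : ∀ z ∈ Z, bmin < f₂ z / f₁ z ∧ f₂ z / f₁ z < bmax)
    (hD3 : IntegrableOn (fun z => f₁ z ^ 3 / f₂ z ^ 2) Z)
    (lam T β : ℝ) (hlam : 0 < lam) (hT : 0 < T) (hβ1 : β < 1) (hβ0 : β ≠ 0)
    (Cl Cu L : ℝ) (hCl : 0 < Cl)
    (g : ℝ → ℝ → ℝ)
    (hgb : ∀ t ∈ Set.Icc (0 : ℝ) T, ∀ x ∈ Set.Icc (0 : ℝ) 1, Cl ≤ g t x ∧ g t x ≤ Cu)
    (hgL : ∀ t ∈ Set.Icc (0 : ℝ) T, ∀ x ∈ Set.Icc (0 : ℝ) 1, ∀ y ∈ Set.Icc (0 : ℝ) 1,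
      |g t x - g t y| ≤ L * |x - y|)
    (fhat : ℝ → ℝ → ℝ) (hfhat : fhat = fun x z => f₁ z * x + f₂ z * (1 - x))
    (ξ : ℝ → ℝ → ℝ) (hξ : ξ = fun x z => f₁ z * x / fhat x z)
    (Iβ : ℝ → ℝ → ℝ)
    (hIβ : Iβ = fun t x => (1 - β) * lam *
      ∫ z in Z, (g t x ^ (β / (β - 1)) * g t (ξ x z) ^ ((1 : ℝ) / (1 - β)) - g t x)
        * fhat x z) :
    (∃ Cb : ℝ, ∀ t ∈ Set.Icc (0 : ℝ) T, ∀ x ∈ Set.Icc (0 : ℝ) 1, |Iβ t x| ≤ Cb) ∧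
    ∃ C' : ℝ, 0 < C' ∧ ∀ t ∈ Set.Icc (0 : ℝ) T, ∀ x ∈ Set.Icc (0 : ℝ) 1,
      ∀ y ∈ Set.Icc (0 : ℝ) 1, |Iβ t x - Iβ t y| ≤ C' * |x - y| := by
  have h00 : (0:ℝ) ∈ Icc (0:ℝ) T := ⟨le_rfl, hT.le⟩
  have hL : 0 ≤ L := by
    have := hgL 0 h00 0 ⟨le_rfl, zero_le_one⟩ 1 ⟨zero_le_one, le_rfl⟩
    have h2 := (abs_nonneg _).trans this
    norm_num at h2
    exact h2
  have hCu : 0 ≤ Cu := by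
    have := hgb 0 h00 0 ⟨le_rfl, zero_le_one⟩
    linarith
  obtain ⟨MA, KA, hMA, hKA, hA, hAL⟩ := aux_rpow Cl Cu (β / (β - 1)) hCl
  obtain ⟨MB, KB, hMB, hKB, hB, hBL⟩ := aux_rpow Cl Cu ((1:ℝ) / (1 - β)) hCl
  have hfh : ∀ x z, fhat x z = f₁ z * x + f₂ z * (1 - x) := fun x z => by rw [hfhat]
  have hxi : ∀ x z, ξ x z = f₁ z * x / (f₁ z * x + f₂ z * (1 - x)) := fun x z => by
    rw [hξ]; simp only [hfh]
  have hc : 0 < (1 - β) * lam := mul_pos (by linarith) hlam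
  set F : ℝ → ℝ → ℝ → ℝ := fun t x z =>
    (g t x ^ (β / (β - 1)) * g t (ξ x z) ^ ((1 : ℝ) / (1 - β)) - g t x) * fhat x z with hF
  have hI : ∀ t x, Iβ t x = (1 - β) * lam * ∫ z in Z, F t x z := fun t x => by rw [hIβ]
  have hsint : IntegrableOn (fun z => f₁ z + f₂ z) Z := hf₁int.add hf₂int
  have hs2 : ∫ z in Z, (f₁ z + f₂ z) = 2 := by
    rw [integral_add hf₁int hf₂int, hf₁d, hf₂d]; norm_num
  have hFb : ∀ t ∈ Icc (0:ℝ) T, ∀ x ∈ Icc (0:ℝ) 1, ∀ z ∈ Z,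
      ‖F t x z‖ ≤ (MA * MB + Cu) * (f₁ z + f₂ z) := by
    intro t ht x hx z hz
    obtain ⟨hp, hps, hm⟩ := aux_xi _ _ x (hf₁pos z hz) (hf₂pos z hz) hx
    rw [← hxi] at hm
    rw [← hfh] at hp hps
    have hg := hgb t ht x hx
    rw [hF, Real.norm_eq_abs]
    simp only
    rw [abs_mul, abs_of_pos hp]
    refine mul_le_mul ?_ hps hp.le (by positivity)
    refine (abs_sub _ _).trans (add_le_add ?_ ?_)
    · rw [abs_mul]
      exact mul_le_mul (hA _ hg) (hB _ (hgb t ht _ hm)) (abs_nonneg _) hMA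
    · rw [abs_of_pos (by linarith)]; exact hg.2
  have hFi : ∀ t ∈ Icc (0:ℝ) T, ∀ x ∈ Icc (0:ℝ) 1, IntegrableOn (F t x) Z := by
    intro t ht x hx
    refine Integrable.mono' (hsint.const_mul (MA * MB + Cu)) ?_
      ((ae_restrict_iff' hZ).2 (Filter.Eventually.of_forall (hFb t ht x hx)))
    have hcont : ContinuousOn (g t) (Icc 0 1) := by
      have : LipschitzOnWith (Real.toNNReal L) (g t) (Icc 0 1) :=
        LipschitzOnWith.of_dist_le_mul (fun u hu v hv => by
          rw [Real.dist_eq, Real.dist_eq, Real.coe_toNNReal L hL]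
          exact hgL t ht u hu v hv)
      exact this.continuousOn
    have hcont' : Continuous (IccExtend (zero_le_one' ℝ) ((Icc (0:ℝ) 1).restrict (g t))) :=
      (continuousOn_iff_continuous_restrict.1 hcont).Icc_extend'
    have hxm : Measurable (ξ x) := by
      have : ξ x = fun z => f₁ z * x / (f₁ z * x + f₂ z * (1 - x)) := funext (hxi x)
      rw [this]; fun_prop
    have hfm : Measurable (fhat x) := by
      have : fhat x = fun z => (f₁ z * x + f₂ z * (1 - x)) := funext (hfh x)
      rw [this]; fun_prop
    have hm : Measurable (fun z => (g t x ^ (β / (β - 1)) *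
        (IccExtend (zero_le_one' ℝ) ((Icc (0:ℝ) 1).restrict (g t)) (ξ x z)) ^ ((1 : ℝ) / (1 - β))
          - g t x) * fhat x z) := by
      have := hcont'.measurable.comp hxm
      exact (((this.pow_const _).const_mul _).sub_const _).mul hfm
    refine hm.aestronglyMeasurable.congr ((ae_restrict_iff' hZ).2 (Filter.Eventually.of_forall ?_))
    intro z hz
    obtain ⟨-, -, hmm⟩ := aux_xi _ _ x (hf₁pos z hz) (hf₂pos z hz) hx
    rw [← hxi] at hmm
    simp only [hF]
    rw [IccExtend_of_mem _ _ hmm]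
    rfl
  refine ⟨⟨(1 - β) * lam * ((MA * MB + Cu) * 2), ?_⟩, ?_⟩
  · intro t ht x hx
    rw [hI, abs_mul, abs_of_pos hc]
    refine mul_le_mul_of_nonneg_left ?_ hc.le
    rw [← hs2, ← integral_const_mul, ← Real.norm_eq_abs]
    exact norm_integral_le_of_norm_le (hsint.const_mul _)
      ((ae_restrict_iff' hZ).2 (Filter.Eventually.of_forall (hFb t ht x hx)))
  · set K := KA * L * MB + MA * (KB * L) + MA * MB + L + Cu with hK
    have hK0 : 0 ≤ K := by positivity
    refine ⟨(1 - β) * lam * (K * 2) + 1, by positivity, ?_⟩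
    intro t ht x hx y hy
    have key : |(∫ z in Z, F t x z) - ∫ z in Z, F t y z| ≤ K * |x - y| * 2 := by
      rw [← integral_sub (hFi t ht x hx) (hFi t ht y hy), ← hs2, ← integral_const_mul,
        ← Real.norm_eq_abs]
      refine norm_integral_le_of_norm_le (hsint.const_mul _)
        ((ae_restrict_iff' hZ).2 (Filter.Eventually.of_forall ?_))
      intro z hz
      have h1 := hf₁pos z hz
      have h2 := hf₂pos z hz
      obtain ⟨hp, hps, hm⟩ := aux_xi _ _ x h1 h2 hx
      obtain ⟨hp', hps', hm'⟩ := aux_xi _ _ y h1 h2 hy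
      have hlip := aux_xi_lip _ _ x y h1 h2 hx hy
      rw [← hxi, ← hxi, ← hfh] at hlip
      rw [← hxi] at hm hm'
      rw [← hfh] at hp hps
      have hg := hgb t ht x hx
      have hg' := hgb t ht y hy
      have hgx := hgb t ht _ hm
      have hgx' := hgb t ht _ hm'
      have hgl := hgL t ht x hx y hy
      rw [Real.norm_eq_abs]
      refine aux_alg _ _ _ _ _ _ _ _ (f₁ z + f₂ z) |x - y| MA MB Cu (KA * L) (KB * L) L
        hMA hMB hCu (by positivity) hL (abs_nonneg _) hp.le hps (hA _ hg') (hB _ hgx) (hB _ hgx')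
        (by rw [abs_of_pos (by linarith)]; exact hg'.2) ?_ ?_ hgl ?_
      · refine (hAL _ hg _ hg').trans ?_
        rw [mul_assoc]
        exact mul_le_mul_of_nonneg_left hgl hKA
      · calc _ ≤ KB * (L * |ξ x z - ξ y z|) * fhat x z := by
              refine mul_le_mul_of_nonneg_right ((hBL _ hgx _ hgx').trans ?_) hp.le
              exact mul_le_mul_of_nonneg_left (hgL t ht _ hm _ hm') hKB
          _ = KB * L * (|ξ x z - ξ y z| * fhat x z) := by ring
          _ ≤ _ := mul_le_mul_of_nonneg_left hlip (by positivity)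
      · rw [hfh, hfh, show f₁ z * x + f₂ z * (1 - x) - (f₁ z * y + f₂ z * (1 - y)) =
          (f₁ z - f₂ z) * (x - y) by ring, abs_mul]
        refine mul_le_mul_of_nonneg_right ?_ (abs_nonneg _)
        rw [abs_le]; constructor <;> linarith
    rw [hI, hI, ← mul_sub, abs_mul, abs_of_pos hc]
    have := mul_le_mul_of_nonneg_left key hc.le
    have := abs_nonneg (x - y)
    linarith
end

section
/- Let $p, q > 0$ and $x, y \in [0,1]$. Then $\left|\frac{px}{px + q(1-x)} - \frac{py}{py + q(1-y)}\right| \le \max\left\{\frac{p}{q}, \frac{q}{p}\right\}\,|x - y|$, and moreover $0 \le \frac{px}{px+q(1-x)} \le 1$ for all $x \in [0,1]$. -/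
/-- For `p, q > 0` and `x, y ∈ [0,1]`, the Bayesian update map
`x ↦ px/(px + q(1-x))` is Lipschitz with constant `max{p/q, q/p}` and takes
values in `[0,1]`. -/
theorem bayesian_update_lipschitz (p q : ℝ) (hp : 0 < p) (hq : 0 < q)
    (x y : ℝ) (hx : x ∈ Set.Icc (0 : ℝ) 1) (hy : y ∈ Set.Icc (0 : ℝ) 1) :
    |p * x / (p * x + q * (1 - x)) - p * y / (p * y + q * (1 - y))| ≤
      max (p / q) (q / p) * |x - y| ∧
    ∀ x' ∈ Set.Icc (0 : ℝ) 1,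
      0 ≤ p * x' / (p * x' + q * (1 - x')) ∧ p * x' / (p * x' + q * (1 - x')) ≤ 1 := by
  have hD : ∀ z ∈ Set.Icc (0 : ℝ) 1, min p q ≤ p * z + q * (1 - z) := by
    rintro z ⟨h0, h1⟩
    have a := mul_le_mul_of_nonneg_right (min_le_left p q) h0
    have b := mul_le_mul_of_nonneg_right (min_le_right p q) (sub_nonneg.2 h1)
    linarith
  have hm : 0 < min p q := lt_min hp hq
  constructor
  · have h1 := hD x hx
    have h2 := hD y hy
    have e : p * x / (p * x + q * (1 - x)) - p * y / (p * y + q * (1 - y)) =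
        p * q / ((p * x + q * (1 - x)) * (p * y + q * (1 - y))) * (x - y) := by
      have n1 : p * x + q * (1 - x) ≠ 0 := by linarith
      have n2 : p * y + q * (1 - y) ≠ 0 := by linarith
      rw [div_sub_div _ _ n1 n2, div_mul_eq_mul_div]
      congr 1
      ring
    have h3 : min p q * min p q ≤ (p * x + q * (1 - x)) * (p * y + q * (1 - y)) :=
      mul_le_mul h1 h2 hm.le (by linarith)
    have h4 : 0 < min p q * min p q := mul_pos hm hm
    rw [e, abs_mul, abs_of_pos (div_pos (mul_pos hp hq) (lt_of_lt_of_le h4 h3))]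
    refine mul_le_mul_of_nonneg_right ?_ (abs_nonneg _)
    refine (div_le_div_of_nonneg_left (mul_pos hp hq).le h4 h3).trans ?_
    rcases le_total p q with h | h
    · rw [min_eq_left h, mul_div_mul_left _ _ hp.ne']
      exact le_max_right _ _
    · rw [min_eq_right h, mul_div_mul_right _ _ hq.ne']
      exact le_max_left _ _
  · intro z hz
    have h1 := hD z hz
    have h2 := mul_nonneg hq.le (sub_nonneg.2 hz.2)
    exact ⟨div_nonneg (mul_nonneg hp.le hz.1) (by linarith),
      (div_le_one (by linarith)).2 (by linarith)⟩
end
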